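/- The function Z ↦ ‖Z‖₄ defined on the n×n complex matrices M_n by ‖Z‖₄⁴ = (1/24)[(tr Z)² tr(Z*)² + tr(Z*)² tr(Z²) + 4 tr(Z) tr(Z*) tr(Z*Z) + 2 tr(Z*Z)² + (tr Z)² tr(Z*²) + tr(Z²) tr(Z*²) + 4 tr(Z*) tr(Z*Z²) + 4 tr(Z) tr(Z*²Z) + 2 tr(Z*ZZ*Z) + 4 tr(Z*²Z²)] is a norm on M_n, and for Hermitian A it satisfies ‖A‖₄⁴ = h₄(λ₁, …, λ_n), the complete homogeneous symmetric polynomial of degree 4 in the eigenvalues λ₁ ≥ ⋯ ≥ λ_n of A. -/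

import Mathlib

open MeasureTheory ProbabilityTheory Matrix

/-- The eigenvalues of a Hermitian matrix, listed in nonincreasing order. -/
noncomputable def eigVec {n : ℕ} {A : Matrix (Fin n) (Fin n) ℂ} (hA : A.IsHermitian) :
    Fin n → ℝ :=
  fun i => hA.eigenvalues (Tuple.sort hA.eigenvalues i.rev)

/-- `N` is a norm on the ℂ-vector space of `n × n` complex matrices. -/
def IsNormOnMn {n : ℕ} (N : Matrix (Fin n) (Fin n) ℂ → ℝ) : Prop :=
  (∀ Z : Matrix (Fin n) (Fin n) ℂ, N Z = 0 ↔ Z = 0) ∧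
  (∀ (c : ℂ) (Z : Matrix (Fin n) (Fin n) ℂ), N (c • Z) = ‖c‖ * N Z) ∧
  (∀ Z W : Matrix (Fin n) (Fin n) ℂ, N (Z + W) ≤ N Z + N W)

/-- The trace polynomial `24 ‖Z‖₄⁴` of the extended complete homogeneous symmetric norm. -/
noncomputable def traceExpr4 {n : ℕ} (Z : Matrix (Fin n) (Fin n) ℂ) : ℂ :=
  (1 / 24 : ℂ) *
    (Z.trace ^ 2 * (Zᴴ).trace ^ 2 + (Zᴴ).trace ^ 2 * (Z ^ 2).trace
      + 4 * Z.trace * (Zᴴ).trace * (Zᴴ * Z).trace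
      + 2 * (Zᴴ * Z).trace ^ 2
      + Z.trace ^ 2 * (Zᴴ ^ 2).trace
      + (Z ^ 2).trace * (Zᴴ ^ 2).trace
      + 4 * (Zᴴ).trace * (Zᴴ * Z ^ 2).trace
      + 4 * Z.trace * (Zᴴ ^ 2 * Z).trace
      + 2 * (Zᴴ * Z * Zᴴ * Z).trace
      + 4 * (Zᴴ ^ 2 * Z ^ 2).trace)

open scoped Classical in
/-- The complete homogeneous symmetric polynomial of degree 4:
`h₄(l) = Σ_{1 ≤ k₁ ≤ k₂ ≤ k₃ ≤ k₄ ≤ n} l_{k₁} l_{k₂} l_{k₃} l_{k₄}`. -/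
noncomputable def completeHomog4 (n : ℕ) (l : Fin n → ℝ) : ℝ :=
  ∑ k ∈ Finset.univ.filter (fun k : Fin 4 → Fin n => ∀ i j : Fin 4, i ≤ j → k i ≤ k j),
    ∏ j, l (k j)

section PermTrace

variable {κ ι R : Type*} [Fintype κ] [DecidableEq κ] [Fintype ι]

/-- The product of traces of products of the matrices `M k` along the cycles of `σ`. -/
noncomputable def permTrace [CommSemiring R] (M : κ → Matrix ι ι R) (σ : Equiv.Perm κ) : R :=
  ∑ j : κ → ι, ∏ k, M k (j (σ k)) (j k)

theorem permTrace_conj [CommSemiring R] (M : κ → Matrix ι ι R) (σ τ : Equiv.Perm κ) :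
    permTrace M (τ * σ * τ⁻¹) = permTrace (M ∘ τ) σ := by
  unfold permTrace
  refine Fintype.sum_equiv (τ.symm.arrowCongr (Equiv.refl ι)) _ _ fun j => ?_
  refine (Fintype.prod_equiv τ _ _ fun k => ?_).symm
  simp

theorem sum_fin_two_arrow [AddCommMonoid R] (f : (Fin 2 → ι) → R) :
    ∑ j, f j = ∑ a, ∑ b, f ![a, b] := by
  simp only [← (Fin.consEquiv (fun _ => ι)).sum_comp, Fintype.sum_prod_type]
  simp
  rfl

theorem sum_fin_four_arrow [AddCommMonoid R] (f : (Fin 4 → ι) → R) :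
    ∑ j, f j = ∑ a, ∑ b, ∑ c, ∑ d, f ![a, b, c, d] := by
  simp only [← (Fin.consEquiv (fun _ => ι)).sum_comp, Fintype.sum_prod_type]
  simp
  rfl

theorem permTrace_one [CommSemiring R] (M : κ → Matrix ι ι R) :
    permTrace M 1 = ∏ k, (M k).trace := by
  classical
  simp [permTrace, trace, Fintype.prod_sum]

theorem permTrace_two_swap [CommSemiring R] (M : Fin 2 → Matrix ι ι R) :
    permTrace M (Equiv.swap 0 1) = (M 0 * M 1).trace := by
  simp only [permTrace, sum_fin_two_arrow, trace, diag_apply, mul_apply, Fin.prod_univ_two]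
  rw [Finset.sum_comm]
  simp

section Four

variable [CommSemiring R] (M : Fin 4 → Matrix ι ι R) (σ : Equiv.Perm (Fin 4)) (a b c d : Fin 4)

theorem permTrace_fin_four (h : Function.Bijective ![a, b, c, d]) :
    permTrace M σ = ∑ j : Fin 4 → ι, M a (j ((Equiv.ofBijective _ h).symm (σ a))) (j 0) *
      M b (j ((Equiv.ofBijective _ h).symm (σ b))) (j 1) *
      M c (j ((Equiv.ofBijective _ h).symm (σ c))) (j 2) *
      M d (j ((Equiv.ofBijective _ h).symm (σ d))) (j 3) := by
  set τ := Equiv.ofBijective _ h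
  have hσ : σ = τ * (τ⁻¹ * σ * τ) * τ⁻¹ := by group
  rw [hσ, permTrace_conj, ← hσ]
  simp only [permTrace, Fin.prod_univ_four]
  rfl

theorem permTrace_fin_four_transposition (h : Function.Bijective ![a, b, c, d])
    (ha : σ a = b) (hb : σ b = a) (hc : σ c = c) (hd : σ d = d) :
    permTrace M σ = (M b * M a).trace * (M c).trace * (M d).trace := by
  rw [mul_right_comm]
  have h0 : (Equiv.ofBijective _ h).symm a = 0 := by rw [Equiv.symm_apply_eq]; rfl
  have h1 : (Equiv.ofBijective _ h).symm b = 1 := by rw [Equiv.symm_apply_eq]; rfl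
  have h2 : (Equiv.ofBijective _ h).symm c = 2 := by rw [Equiv.symm_apply_eq]; rfl
  have h3 : (Equiv.ofBijective _ h).symm d = 3 := by rw [Equiv.symm_apply_eq]; rfl
  simp only [permTrace_fin_four M σ a b c d h, ha, hb, hc, hd, h0, h1, h2, h3,
    sum_fin_four_arrow, trace, diag_apply, mul_apply, Finset.sum_mul]
  simp only [Finset.mul_sum, Finset.sum_mul]
  refine Finset.sum_congr rfl fun _ _ => Finset.sum_congr rfl fun _ _ =>
    Finset.sum_congr rfl fun _ _ => Finset.sum_congr rfl fun _ _ => ?_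
  simp
  ring

theorem permTrace_fin_four_two_transpositions (h : Function.Bijective ![a, b, c, d])
    (ha : σ a = b) (hb : σ b = a) (hc : σ c = d) (hd : σ d = c) :
    permTrace M σ = (M b * M a).trace * (M d * M c).trace := by
  have h0 : (Equiv.ofBijective _ h).symm a = 0 := by rw [Equiv.symm_apply_eq]; rfl
  have h1 : (Equiv.ofBijective _ h).symm b = 1 := by rw [Equiv.symm_apply_eq]; rfl
  have h2 : (Equiv.ofBijective _ h).symm c = 2 := by rw [Equiv.symm_apply_eq]; rfl
  have h3 : (Equiv.ofBijective _ h).symm d = 3 := by rw [Equiv.symm_apply_eq]; rfl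
  simp only [permTrace_fin_four M σ a b c d h, ha, hb, hc, hd, h0, h1, h2, h3,
    sum_fin_four_arrow, trace, diag_apply, mul_apply, Finset.sum_mul]
  simp only [Finset.mul_sum]
  refine Finset.sum_congr rfl fun _ _ => Finset.sum_congr rfl fun _ _ =>
    Finset.sum_congr rfl fun _ _ => Finset.sum_congr rfl fun _ _ => ?_
  simp
  ring

theorem permTrace_fin_four_three_cycle (h : Function.Bijective ![a, b, c, d])
    (ha : σ a = b) (hb : σ b = c) (hc : σ c = a) (hd : σ d = d) :
    permTrace M σ = (M c * M b * M a).trace * (M d).trace := by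
  have h0 : (Equiv.ofBijective _ h).symm a = 0 := by rw [Equiv.symm_apply_eq]; rfl
  have h1 : (Equiv.ofBijective _ h).symm b = 1 := by rw [Equiv.symm_apply_eq]; rfl
  have h2 : (Equiv.ofBijective _ h).symm c = 2 := by rw [Equiv.symm_apply_eq]; rfl
  have h3 : (Equiv.ofBijective _ h).symm d = 3 := by rw [Equiv.symm_apply_eq]; rfl
  simp only [permTrace_fin_four M σ a b c d h, ha, hb, hc, hd, h0, h1, h2, h3,
    sum_fin_four_arrow, trace, diag_apply, mul_apply, Finset.sum_mul]
  simp only [Finset.mul_sum]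
  refine Finset.sum_congr rfl fun _ _ => Finset.sum_congr rfl fun _ _ =>
    Finset.sum_congr rfl fun _ _ => Finset.sum_congr rfl fun _ _ => ?_
  simp
  ring

theorem permTrace_fin_four_four_cycle (h : Function.Bijective ![a, b, c, d])
    (ha : σ a = b) (hb : σ b = c) (hc : σ c = d) (hd : σ d = a) :
    permTrace M σ = (M d * M c * M b * M a).trace := by
  have h0 : (Equiv.ofBijective _ h).symm a = 0 := by rw [Equiv.symm_apply_eq]; rfl
  have h1 : (Equiv.ofBijective _ h).symm b = 1 := by rw [Equiv.symm_apply_eq]; rfl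
  have h2 : (Equiv.ofBijective _ h).symm c = 2 := by rw [Equiv.symm_apply_eq]; rfl
  have h3 : (Equiv.ofBijective _ h).symm d = 3 := by rw [Equiv.symm_apply_eq]; rfl
  simp only [permTrace_fin_four M σ a b c d h, ha, hb, hc, hd, h0, h1, h2, h3,
    sum_fin_four_arrow, trace, diag_apply, mul_apply, Finset.sum_mul]
  refine Finset.sum_congr rfl fun _ _ => Finset.sum_congr rfl fun _ _ =>
    Finset.sum_congr rfl fun _ _ => Finset.sum_congr rfl fun _ _ => ?_
  simp
  ring

end Four

theorem univ_perm_fin_two : (Finset.univ : Finset (Equiv.Perm (Fin 2))).val =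
    ↑[1, Equiv.swap 0 (1 : Fin 2)] := by decide +kernel

theorem univ_perm_fin_four : (Finset.univ : Finset (Equiv.Perm (Fin 4))).val =
    ↑[1, c[0, 1], c[0, 2], c[0, 3], c[1, 2], c[1, 3], c[2, 3],
      c[0, 1] * c[2, 3], c[0, 2] * c[1, 3], c[0, 3] * c[1, 2],
      c[0, 1, 2], c[0, 2, 1], c[0, 1, 3], c[0, 3, 1], c[0, 2, 3], c[0, 3, 2], c[1, 2, 3],
      c[1, 3, 2], c[0, 1, 2, 3], c[0, 1, 3, 2], c[0, 2, 1, 3], c[0, 2, 3, 1], c[0, 3, 1, 2],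
      c[0, 3, 2, (1 : Fin 4)]] := by decide +kernel

theorem sum_perm_fin_two_permTrace (Z Y : Matrix ι ι ℂ) :
    ∑ σ, permTrace ![Z, Y] σ = Z.trace * Y.trace + (Z * Y).trace := by
  rw [Finset.sum, univ_perm_fin_two]
  simp [permTrace_one, permTrace_two_swap]

theorem sum_perm_fin_four_permTrace (Z Y : Matrix ι ι ℂ) :
    ∑ σ, permTrace ![Z, Z, Y, Y] σ =
      Z.trace ^ 2 * Y.trace ^ 2 + Y.trace ^ 2 * (Z * Z).trace + 4 * Z.trace * Y.trace * (Y * Z).trace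
        + 2 * (Y * Z).trace ^ 2 + Z.trace ^ 2 * (Y * Y).trace + (Z * Z).trace * (Y * Y).trace
        + 4 * Y.trace * (Y * (Z * Z)).trace + 4 * Z.trace * (Y * Y * Z).trace
        + 2 * (Y * Z * Y * Z).trace + 4 * (Y * Y * (Z * Z)).trace := by
  rw [Finset.sum, univ_perm_fin_four]
  simp only [Multiset.map_coe, Multiset.sum_coe, List.map_cons, List.map_nil, List.sum_cons,
    List.sum_nil, permTrace_one, Fin.prod_univ_four,
    permTrace_fin_four_transposition _ (c[0, 1]) 0 1 2 3
      (by decide) (by decide) (by decide) (by decide) (by decide),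
    permTrace_fin_four_transposition _ (c[0, 2]) 0 2 1 3
      (by decide) (by decide) (by decide) (by decide) (by decide),
    permTrace_fin_four_transposition _ (c[0, 3]) 0 3 1 2
      (by decide) (by decide) (by decide) (by decide) (by decide),
    permTrace_fin_four_transposition _ (c[1, 2]) 1 2 0 3
      (by decide) (by decide) (by decide) (by decide) (by decide),
    permTrace_fin_four_transposition _ (c[1, 3]) 1 3 0 2
      (by decide) (by decide) (by decide) (by decide) (by decide),
    permTrace_fin_four_transposition _ (c[2, 3]) 2 3 0 1
      (by decide) (by decide) (by decide) (by decide) (by decide),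
    permTrace_fin_four_two_transpositions _ (c[0, 1] * c[2, 3]) 0 1 2 3
      (by decide) (by decide) (by decide) (by decide) (by decide),
    permTrace_fin_four_two_transpositions _ (c[0, 2] * c[1, 3]) 0 2 1 3
      (by decide) (by decide) (by decide) (by decide) (by decide),
    permTrace_fin_four_two_transpositions _ (c[0, 3] * c[1, 2]) 0 3 1 2
      (by decide) (by decide) (by decide) (by decide) (by decide),
    permTrace_fin_four_three_cycle _ (c[0, 1, 2]) 0 1 2 3
      (by decide) (by decide) (by decide) (by decide) (by decide),
    permTrace_fin_four_three_cycle _ (c[0, 2, 1]) 0 2 1 3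
      (by decide) (by decide) (by decide) (by decide) (by decide),
    permTrace_fin_four_three_cycle _ (c[0, 1, 3]) 0 1 3 2
      (by decide) (by decide) (by decide) (by decide) (by decide),
    permTrace_fin_four_three_cycle _ (c[0, 3, 1]) 0 3 1 2
      (by decide) (by decide) (by decide) (by decide) (by decide),
    permTrace_fin_four_three_cycle _ (c[0, 2, 3]) 0 2 3 1
      (by decide) (by decide) (by decide) (by decide) (by decide),
    permTrace_fin_four_three_cycle _ (c[0, 3, 2]) 0 3 2 1
      (by decide) (by decide) (by decide) (by decide) (by decide),
    permTrace_fin_four_three_cycle _ (c[1, 2, 3]) 1 2 3 0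
      (by decide) (by decide) (by decide) (by decide) (by decide),
    permTrace_fin_four_three_cycle _ (c[1, 3, 2]) 1 3 2 0
      (by decide) (by decide) (by decide) (by decide) (by decide),
    permTrace_fin_four_four_cycle _ (c[0, 1, 2, 3]) 0 1 2 3
      (by decide) (by decide) (by decide) (by decide) (by decide),
    permTrace_fin_four_four_cycle _ (c[0, 1, 3, 2]) 0 1 3 2
      (by decide) (by decide) (by decide) (by decide) (by decide),
    permTrace_fin_four_four_cycle _ (c[0, 2, 1, 3]) 0 2 1 3
      (by decide) (by decide) (by decide) (by decide) (by decide),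
    permTrace_fin_four_four_cycle _ (c[0, 2, 3, 1]) 0 2 3 1
      (by decide) (by decide) (by decide) (by decide) (by decide),
    permTrace_fin_four_four_cycle _ (c[0, 3, 1, 2]) 0 3 1 2
      (by decide) (by decide) (by decide) (by decide) (by decide),
    permTrace_fin_four_four_cycle _ (c[0, 3, 2, 1]) 0 3 2 1
      (by decide) (by decide) (by decide) (by decide) (by decide)]
  have h0 : ![Z, Z, Y, Y] 0 = Z := rfl
  have h1 : ![Z, Z, Y, Y] 1 = Z := rfl
  have h2 : ![Z, Z, Y, Y] 2 = Y := rfl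
  have h3 : ![Z, Z, Y, Y] 3 = Y := rfl
  have e2 : (Z * Y * Z).trace = (Y * (Z * Z)).trace := by rw [trace_mul_cycle', mul_assoc]
  have e3 : (Z * Y * Y * Z).trace = (Y * Y * (Z * Z)).trace := by
    rw [mul_assoc Z Y Y, trace_mul_comm (Z * (Y * Y)) Z, ← mul_assoc, trace_mul_comm]
  simp only [h0, h1, h2, h3, e2, e3, mul_assoc Y Z Z, mul_assoc (Y * Y) Z Z]
  ring

end PermTrace
section Wick

variable {κ ι S : Type*} [Fintype κ] [DecidableEq κ] [Fintype ι] [DecidableEq ι] [Fintype S]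

/-- The number of permutations carrying one tuple to another. -/
theorem card_perm_comp_eq (i j : κ → ι) :
    (Fintype.card {σ : Equiv.Perm κ // i = j ∘ σ}) =
      ∏ v, if Fintype.card {k // i k = v} = Fintype.card {k // j k = v}
        then (Fintype.card {k // i k = v}).factorial else 0 := by
  by_cases h : ∀ v, Fintype.card {k // i k = v} = Fintype.card {k // j k = v}
  · simp only [h, if_true]
    let σ₀ : Equiv.Perm κ := Equiv.ofFiberEquiv fun v => Fintype.equivOfCardEq (h v)
    have hσ₀ : i = j ∘ σ₀ := by
      ext k
      exact (Equiv.ofFiberEquiv_map _ _).symm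
    rw [← DomMulAct.stabilizer_card j]
    refine Fintype.card_congr ⟨fun σ => ⟨σ * σ₀⁻¹, ?_⟩, fun σ => ⟨σ * σ₀, ?_⟩, ?_, ?_⟩
    · ext k
      have := congrFun (σ.2.symm.trans hσ₀) (σ₀⁻¹ k)
      simpa using this
    · ext k
      have := congrFun σ.2 (σ₀ k)
      simpa [hσ₀] using this.symm
    · intro σ; ext; simp
    · intro σ; ext; simp
  · push Not at h
    obtain ⟨v, hv⟩ := h
    rw [Finset.prod_eq_zero (Finset.mem_univ v) (if_neg hv), Fintype.card_eq_zero_iff]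
    refine ⟨fun ⟨σ, hσ⟩ => hv (Fintype.card_congr (σ.subtypeEquiv fun k => ?_))⟩
    simp [hσ]

theorem sum_perm_permTrace (M : κ → Matrix ι ι ℂ) :
    ∑ σ, permTrace M σ = ∑ i : κ → ι, ∑ j : κ → ι,
      (∏ k, M k (i k) (j k)) * Fintype.card {σ : Equiv.Perm κ // i = j ∘ σ} := by
  have h : ∀ σ : Equiv.Perm κ, permTrace M σ = ∑ i : κ → ι, ∑ j : κ → ι,
      if i = j ∘ σ then ∏ k, M k (i k) (j k) else 0 := by
    intro σ
    rw [Finset.sum_comm]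
    simp [permTrace]
  simp only [h]
  rw [Finset.sum_comm]
  refine Finset.sum_congr rfl fun i _ => ?_
  rw [Finset.sum_comm]
  refine Finset.sum_congr rfl fun j _ => ?_
  rw [Finset.sum_ite, Finset.sum_const_zero, add_zero, Finset.sum_const, Fintype.card_subtype,
    nsmul_eq_mul, mul_comm]

/-- **Wick's formula** for a finitely supported distribution whose low moments agree with those of
the standard complex Gaussian. -/
theorem sum_prod_quadratic_form (w : S → ℂ) (x : S → ℂ)
    (hx : ∀ a b, a ≤ Fintype.card κ → b ≤ Fintype.card κ →
      ∑ t, w t * (star (x t) ^ a * x t ^ b) = if a = b then (a.factorial : ℂ) else 0)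
    (M : κ → Matrix ι ι ℂ) :
    ∑ s : ι → S, (∏ v, w (s v)) * ∏ k, ∑ i, ∑ j, star (x (s i)) * M k i j * x (s j) =
      ∑ σ, permTrace M σ := by
  rw [sum_perm_permTrace]
  simp only [Fintype.prod_sum, Finset.mul_sum]
  rw [Finset.sum_comm]
  refine Finset.sum_congr rfl fun i _ => ?_
  rw [Finset.sum_comm]
  refine Finset.sum_congr rfl fun j _ => ?_
  have h : ∀ s : ι → S, (∏ v, w (s v)) * ∏ k, star (x (s (i k))) * M k (i k) (j k) * x (s (j k)) =
      (∏ k, M k (i k) (j k)) * ∏ v, w (s v) * (star (x (s v)) ^ Fintype.card {k // i k = v} *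
        x (s v) ^ Fintype.card {k // j k = v}) := by
    intro s
    simp only [Finset.prod_mul_distrib]
    rw [← Fintype.prod_fiberwise' i (fun v => star (x (s v))),
      ← Fintype.prod_fiberwise' j (fun v => x (s v))]
    simp only [Finset.prod_const, Finset.card_univ]
    ring
  simp only [h, ← Finset.mul_sum]
  rw [← Fintype.prod_sum (fun v t => w t * (star (x t) ^ Fintype.card {k // i k = v} *
        x t ^ Fintype.card {k // j k = v})), card_perm_comp_eq, Nat.cast_prod]
  congr 1
  refine Finset.prod_congr rfl fun v _ => ?_
  rw [hx _ _ (Fintype.card_subtype_le _) (Fintype.card_subtype_le _)]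
  split_ifs <;> simp

end Wick

section Homog

theorem card_perm_monotone_eq {d n : ℕ} (j : Fin d → Fin n) :
    Fintype.card {σ : Equiv.Perm (Fin d) // j = j ∘ σ} =
      (Finset.univ.filter fun σ : Equiv.Perm (Fin d) => Monotone (j ∘ σ)).card := by
  classical
  rw [← Fintype.card_subtype]
  refine Fintype.card_congr ((Equiv.mulRight (Tuple.sort j)).subtypeEquiv fun σ => ?_)
  rw [← Tuple.comp_sort_eq_comp_iff_monotone, Equiv.coe_mulRight, Equiv.Perm.coe_mul,
    ← Function.comp_assoc]
  exact ((Tuple.sort j).surjective.injective_comp_right.eq_iff.trans eq_comm).symm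

theorem sum_prod_mul_card_perm {d n : ℕ} (l : Fin n → ℂ) :
    ∑ j : Fin d → Fin n, (∏ k, l (j k)) * Fintype.card {σ : Equiv.Perm (Fin d) // j = j ∘ σ} =
      d.factorial * ∑ j : Fin d → Fin n with Monotone j, ∏ k, l (j k) := by
  simp only [card_perm_monotone_eq, Finset.card_filter, Nat.cast_sum, Finset.mul_sum]
  rw [Finset.sum_comm]
  have h : ∀ σ : Equiv.Perm (Fin d), ∑ j : Fin d → Fin n,
      (∏ k, l (j k)) * ((if Monotone (j ∘ σ) then 1 else 0 : ℕ) : ℂ) =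
        ∑ j : Fin d → Fin n with Monotone j, ∏ k, l (j k) := by
    intro σ
    rw [Finset.sum_filter]
    refine Fintype.sum_equiv (σ.symm.arrowCongr (Equiv.refl _)) _ _ fun j => ?_
    have : ∏ k, l (j k) = ∏ k, l (j (σ k)) := (Equiv.prod_comp σ (fun k => l (j k))).symm
    rw [this]
    simp [Equiv.arrowCongr, Function.comp_def]
  rw [Finset.sum_congr rfl fun σ _ => h σ, Finset.sum_const, Finset.card_univ, Fintype.card_perm,
    Fintype.card_fin, nsmul_eq_mul, Finset.mul_sum]

end Homog

/-- There is a finitely supported distribution on `ℂ` whose mixed moments up to bidegree `(4, 4)` are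
those of the standard complex Gaussian. -/
theorem exists_finite_gaussian_moments :
    ∃ (w : Fin 4 × Fin 5 → ℝ) (x : Fin 4 × Fin 5 → ℂ), (∀ t, 0 ≤ w t) ∧
      ∀ a b, a ≤ 4 → b ≤ 4 →
        ∑ t, (w t : ℂ) * (star (x t) ^ a * x t ^ b) = if a = b then (a.factorial : ℂ) else 0 := by
  have hζ := Complex.isPrimitiveRoot_exp 5 (by norm_num)
  set ζ := Complex.exp (2 * Real.pi * Complex.I / (5 : ℕ))
  have hζs : star ζ = ζ ^ 4 := by
    have h1 : ‖ζ‖ = 1 := hζ.norm'_eq_one (by norm_num)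
    have h2 : star ζ * ζ = 1 := by
      have := Complex.conj_mul' ζ
      simpa [h1] using this
    have h3 : ζ ^ 4 * ζ = 1 := by rw [← pow_succ]; exact hζ.pow_eq_one
    exact mul_right_cancel₀ (hζ.ne_zero (by norm_num)) (h2.trans h3.symm)
  refine ⟨fun t => ![3 / 10, 1 / 2, 1 / 6, 1 / 30] t.1 / 5,
    fun t => (√(![0, 1, 2, 5] t.1) : ℝ) * ζ ^ (t.2 : ℕ), ?_, ?_⟩
  · rintro ⟨p, k⟩
    fin_cases p <;> simp <;> norm_num
  intro a b ha hb
  have hgeom : ∑ k : Fin 5, (ζ ^ (4 * a + b)) ^ (k : ℕ) = if a = b then 5 else 0 := by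
    rw [Fin.sum_univ_eq_sum_range (fun k => (ζ ^ (4 * a + b)) ^ k)]
    split_ifs with hab
    · have : ζ ^ (4 * a + b) = 1 := (hζ.pow_eq_one_iff_dvd _).2 (by omega)
      simp [this]
    · have h1 : ζ ^ (4 * a + b) ≠ 1 := fun h => hab (by
        have := (hζ.pow_eq_one_iff_dvd _).1 h
        omega)
      rw [geom_sum_eq h1, ← pow_mul, mul_comm, pow_mul, hζ.pow_eq_one]
      simp
  have hterm : ∀ (r c : ℝ) (k : ℕ), (c : ℂ) * (star ((r : ℂ) * ζ ^ k) ^ a * ((r : ℂ) * ζ ^ k) ^ b) =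
      c * r ^ (a + b) * (ζ ^ (4 * a + b)) ^ k := by
    intro r c k
    rw [star_mul', star_pow, hζs, Complex.star_def, Complex.conj_ofReal]
    ring
  simp only [hterm, Fintype.sum_prod_type, ← Finset.mul_sum, hgeom]
  split_ifs with hab
  · subst hab
    have hr : ∀ r : ℝ, 0 ≤ r → ((√r : ℝ) : ℂ) ^ (a + a) = (r : ℂ) ^ a := fun r hr => by
      rw [← two_mul, pow_mul, ← Complex.ofReal_pow, Real.sq_sqrt hr]
    rw [Fin.sum_univ_four]
    simp only [hr _ (show (0 : ℝ) ≤ ![0, 1, 2, 5] 0 by simp),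
      hr _ (show (0 : ℝ) ≤ ![0, 1, 2, 5] 1 by simp),
      hr _ (show (0 : ℝ) ≤ ![0, 1, 2, 5] 2 by simp), hr _ (show (0 : ℝ) ≤ ![0, 1, 2, 5] 3 by simp)]
    interval_cases a <;> simp [Nat.factorial] <;> norm_num
  · simp

theorem traceExpr4_eq_sum_permTrace {n : ℕ} (Z : Matrix (Fin n) (Fin n) ℂ) :
    traceExpr4 Z = 1 / 24 * ∑ σ, permTrace ![Z, Z, Zᴴ, Zᴴ] σ := by
  rw [sum_perm_fin_four_permTrace, traceExpr4]
  simp only [pow_two, mul_assoc]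

section QuadraticForm

variable {n : ℕ} {S : Type*} (x : S → ℂ) (s : Fin n → S)

/-- The quadratic form of a matrix evaluated at the vector with coordinates `x (s i)`. -/
noncomputable def sampledForm (Z : Matrix (Fin n) (Fin n) ℂ) : ℂ :=
  ∑ i, ∑ j, star (x (s i)) * Z i j * x (s j)

theorem sampledForm_add (Z W : Matrix (Fin n) (Fin n) ℂ) :
    sampledForm x s (Z + W) = sampledForm x s Z + sampledForm x s W := by
  simp [sampledForm, mul_add, add_mul, Finset.sum_add_distrib]

theorem sampledForm_smul (c : ℂ) (Z : Matrix (Fin n) (Fin n) ℂ) :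
    sampledForm x s (c • Z) = c * sampledForm x s Z := by
  simp only [sampledForm, Finset.mul_sum, Matrix.smul_apply, smul_eq_mul]
  exact Finset.sum_congr rfl fun i _ => Finset.sum_congr rfl fun j _ => by ring

theorem sampledForm_conjTranspose (Z : Matrix (Fin n) (Fin n) ℂ) :
    sampledForm x s Zᴴ = star (sampledForm x s Z) := by
  simp only [sampledForm, star_sum, conjTranspose_apply]
  rw [Finset.sum_comm]
  refine Finset.sum_congr rfl fun i _ => Finset.sum_congr rfl fun j _ => ?_
  simp only [star_mul', star_star]
  ring

theorem mul_star_eq_norm_sq (z : ℂ) : z * star z = ((‖z‖ ^ 2 : ℝ) : ℂ) := by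
  rw [Complex.star_def, Complex.mul_conj']
  simp

variable [Fintype S] (w : S → ℝ)

theorem traceExpr4_eq_sum_norm_sampledForm (Z : Matrix (Fin n) (Fin n) ℂ)
    (hx : ∀ a b, a ≤ 4 → b ≤ 4 →
      ∑ t, (w t : ℂ) * (star (x t) ^ a * x t ^ b) = if a = b then (a.factorial : ℂ) else 0) :
    traceExpr4 Z = ((∑ s : Fin n → S, (∏ v, w (s v)) / 24 * ‖sampledForm x s Z‖ ^ 4 : ℝ) : ℂ) := by
  rw [traceExpr4_eq_sum_permTrace, ← sum_prod_quadratic_form _ x (by simpa using hx),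
    Finset.mul_sum, Complex.ofReal_sum]
  refine Finset.sum_congr rfl fun s _ => ?_
  rw [Fin.prod_univ_four]
  change 1 / 24 * (_ * (sampledForm x s Z * sampledForm x s Z * sampledForm x s Zᴴ *
    sampledForm x s Zᴴ)) = _
  have h := mul_star_eq_norm_sq (sampledForm x s Z)
  rw [sampledForm_conjTranspose]
  push_cast at h ⊢
  linear_combination (1 / 24 * ∏ v, (w (s v) : ℂ)) *
    (sampledForm x s Z * star (sampledForm x s Z) + (‖sampledForm x s Z‖ : ℂ) ^ 2) * h

open scoped ComplexOrder in
theorem eq_zero_of_norm_sampledForm_eq_zero (Z : Matrix (Fin n) (Fin n) ℂ)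
    (hx : ∀ a b, a ≤ 4 → b ≤ 4 →
      ∑ t, (w t : ℂ) * (star (x t) ^ a * x t ^ b) = if a = b then (a.factorial : ℂ) else 0)
    (hZ : ∀ s : Fin n → S, (∏ v, w (s v)) = 0 ∨ sampledForm x s Z = 0) : Z = 0 := by
  have h : ∑ σ, permTrace ![Z, Zᴴ] σ = 0 := by
    rw [← sum_prod_quadratic_form (fun t => (w t : ℂ)) x
      (fun a b ha hb => hx a b (ha.trans (by simp)) (hb.trans (by simp)))]
    refine Finset.sum_eq_zero fun s _ => ?_
    rw [Fin.prod_univ_two, ← Complex.ofReal_prod]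
    change _ * (sampledForm x s Z * sampledForm x s Zᴴ) = _
    rcases hZ s with h | h <;> simp [h]
  rw [sum_perm_fin_two_permTrace, trace_conjTranspose, mul_star_eq_norm_sq] at h
  have h1 : 0 ≤ (Z * Zᴴ).trace := (posSemidef_self_mul_conjTranspose Z).trace_nonneg
  have h2 : (0 : ℂ) ≤ ((‖Z.trace‖ ^ 2 : ℝ) : ℂ) := by
    rw [Complex.zero_le_real]
    positivity
  rw [add_eq_zero_iff_of_nonneg h2 h1] at h
  exact trace_mul_conjTranspose_self_eq_zero_iff.1 h.2

end QuadraticForm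

theorem conjStarAlgAut_trace {n : ℕ} (U : unitary (Matrix (Fin n) (Fin n) ℂ))
    (D : Matrix (Fin n) (Fin n) ℂ) :
    (Unitary.conjStarAlgAut ℂ _ U D).trace = D.trace := by
  rw [Unitary.conjStarAlgAut_apply, trace_mul_cycle, Unitary.coe_star_mul_self, one_mul]

theorem sum_eigVec {n : ℕ} {A : Matrix (Fin n) (Fin n) ℂ} (hA : A.IsHermitian) (f : ℝ → ℂ) :
    ∑ i, f (eigVec hA i) = ∑ i, f (hA.eigenvalues i) :=
  Equiv.sum_comp (Fin.revPerm.trans (Tuple.sort hA.eigenvalues)) fun i => f (hA.eigenvalues i)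

theorem trace_pow_eq_sum_eigVec {n : ℕ} {A : Matrix (Fin n) (Fin n) ℂ} (hA : A.IsHermitian) (k : ℕ) :
    (A ^ k).trace = ((diagonal fun i => (eigVec hA i : ℂ)) ^ k).trace := by
  conv_lhs => rw [hA.spectral_theorem]
  rw [← map_pow, conjStarAlgAut_trace, diagonal_pow, diagonal_pow]
  simp [trace_diagonal, sum_eigVec hA (fun t => (t : ℂ) ^ k)]

theorem Matrix.IsHermitian.traceExpr4_eq {n : ℕ} {A : Matrix (Fin n) (Fin n) ℂ} (hA : A.IsHermitian) :
    traceExpr4 A = 1 / 24 * (A.trace ^ 4 + 6 * A.trace ^ 2 * (A ^ 2).trace + 3 * (A ^ 2).trace ^ 2 +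
      8 * A.trace * (A ^ 3).trace + 6 * (A ^ 4).trace) := by
  have h2 : A * A = A ^ 2 := (pow_two A).symm
  have h3 : A * A ^ 2 = A ^ 3 := (pow_succ' A 2).symm
  have h3' : A ^ 2 * A = A ^ 3 := (pow_succ A 2).symm
  have h4 : A ^ 3 * A = A ^ 4 := (pow_succ A 3).symm
  have h4' : A ^ 2 * A ^ 2 = A ^ 4 := (pow_add A 2 2).symm
  simp only [traceExpr4, hA.eq, h2, h3, h3', h4, h4']
  ring

theorem traceExpr4_diagonal {n : ℕ} (l : Fin n → ℝ) :
    traceExpr4 (diagonal fun i => (l i : ℂ)) = (completeHomog4 n l : ℂ) := by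
  have hH : (diagonal fun i => (l i : ℂ))ᴴ = diagonal fun i => (l i : ℂ) := by
    rw [diagonal_conjTranspose]
    congr 1
    ext i
    simp
  have hM : ![diagonal fun i => (l i : ℂ), diagonal fun i => (l i : ℂ), diagonal fun i => (l i : ℂ),
      diagonal fun i => (l i : ℂ)] = fun _ => diagonal fun i => (l i : ℂ) := by
    ext k
    fin_cases k <;> rfl
  have hprod : ∀ i j : Fin 4 → Fin n, ∏ k, diagonal (fun i => (l i : ℂ)) (i k) (j k) =
      if i = j then ∏ k, (l (j k) : ℂ) else 0 := by
    intro i j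
    split_ifs with h
    · simp [h]
    · obtain ⟨k, hk⟩ := Function.ne_iff.1 h
      exact Finset.prod_eq_zero (Finset.mem_univ k) (diagonal_apply_ne _ hk)
  rw [traceExpr4_eq_sum_permTrace, hH, hM, sum_perm_permTrace]
  simp only [hprod, ite_mul, zero_mul, Finset.sum_ite_eq, Finset.mem_univ, if_true]
  rw [sum_prod_mul_card_perm (fun i => (l i : ℂ)), completeHomog4]
  push_cast
  rw [← mul_assoc, show (1 / 24 * (Nat.factorial 4 : ℂ)) = 1 by norm_num [Nat.factorial], one_mul]
  refine Finset.sum_congr ?_ fun _ _ => rfl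
  ext k
  rw [Finset.mem_filter, Finset.mem_filter]
  exact Iff.rfl

/-- The function `Z ↦ ‖Z‖₄` defined by the explicit trace polynomial `‖Z‖₄⁴ = traceExpr4 Z`
is a norm on `Mₙ(ℂ)`, and for Hermitian `A` it satisfies `‖A‖₄⁴ = h₄(λ(A))`. -/
theorem traceExpr4_norm {n : ℕ}
    (N : Matrix (Fin n) (Fin n) ℂ → ℝ)
    (hNnonneg : ∀ Z, 0 ≤ N Z)
    (hN : ∀ Z : Matrix (Fin n) (Fin n) ℂ, ((N Z : ℝ) : ℂ) ^ 4 = traceExpr4 Z) :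
    IsNormOnMn N ∧
    ∀ (A : Matrix (Fin n) (Fin n) ℂ) (hA : A.IsHermitian),
      N A ^ 4 = completeHomog4 n (eigVec hA) := by
  obtain ⟨w, x, hw, hx⟩ := exists_finite_gaussian_moments
  have hW : ∀ s : Fin n → Fin 4 × Fin 5, 0 ≤ (∏ v, w (s v)) / 24 := fun s =>
    div_nonneg (Finset.prod_nonneg fun v _ => hw _) (by norm_num)
  have hsum : ∀ Z, N Z ^ 4 = ∑ s : Fin n → Fin 4 × Fin 5,
      (∏ v, w (s v)) / 24 * ‖sampledForm x s Z‖ ^ 4 := fun Z => by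
    have := (hN Z).trans (traceExpr4_eq_sum_norm_sampledForm x w Z hx)
    exact_mod_cast this
  refine ⟨⟨fun Z => ⟨fun h => ?_, ?_⟩, fun c Z => ?_, fun Z W => ?_⟩, fun A hA => ?_⟩
  · refine eq_zero_of_norm_sampledForm_eq_zero x w Z hx fun s => ?_
    have h0 := hsum Z
    rw [h, zero_pow four_ne_zero, eq_comm, Finset.sum_eq_zero_iff_of_nonneg
      fun s _ => mul_nonneg (hW s) (by positivity)] at h0
    simpa using h0 s (Finset.mem_univ s)
  · rintro rfl
    have h0 := hN 0
    simpa [traceExpr4] using h0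
  · rw [← pow_left_inj₀ (hNnonneg _) (mul_nonneg (norm_nonneg _) (hNnonneg _)) four_ne_zero]
    rw [mul_pow, hsum, hsum, Finset.mul_sum]
    refine Finset.sum_congr rfl fun s _ => ?_
    rw [sampledForm_smul, norm_mul]
    ring
  · set c : (Fin n → Fin 4 × Fin 5) → ℝ := fun s => ((∏ v, w (s v)) / 24) ^ (1 / 4 : ℝ)
    have hc : ∀ s, 0 ≤ c s := fun s => Real.rpow_nonneg (hW s) _
    have hc4 : ∀ s, c s ^ 4 = (∏ v, w (s v)) / 24 := fun s => by
      rw [← Real.rpow_mul_natCast (hW s)]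
      norm_num
    have hNc : ∀ Z, N Z = (∑ s, (c s * ‖sampledForm x s Z‖) ^ (4 : ℝ)) ^ (1 / 4 : ℝ) := fun Z => by
      have : ∑ s, (c s * ‖sampledForm x s Z‖) ^ (4 : ℝ) = N Z ^ (4 : ℝ) := by
        simp only [show (4 : ℝ) = ((4 : ℕ) : ℝ) by norm_num, Real.rpow_natCast, mul_pow, hc4, hsum]
      rw [this, ← Real.rpow_mul (hNnonneg Z)]
      norm_num
    calc N (Z + W) ≤ (∑ s, (c s * ‖sampledForm x s Z‖ + c s * ‖sampledForm x s W‖) ^ (4 : ℝ)) ^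
          (1 / 4 : ℝ) := by
          rw [hNc]
          gcongr with s
          · exact Finset.sum_nonneg fun s _ =>
              Real.rpow_nonneg (mul_nonneg (hc s) (norm_nonneg _)) _
          · exact mul_nonneg (hc s) (norm_nonneg _)
          · rw [sampledForm_add, ← mul_add]
            exact mul_le_mul_of_nonneg_left (norm_add_le _ _) (hc s)
      _ ≤ N Z + N W := by
          rw [hNc Z, hNc W]
          exact Real.Lp_add_le_of_nonneg _ (by norm_num)
            (fun s _ => mul_nonneg (hc s) (norm_nonneg _))
            (fun s _ => mul_nonneg (hc s) (norm_nonneg _))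
  · have hD : (diagonal fun i => (eigVec hA i : ℂ)).IsHermitian :=
      isHermitian_diagonal_of_self_adjoint _ (by ext i; simp)
    have h1 := trace_pow_eq_sum_eigVec hA 1
    rw [pow_one, pow_one] at h1
    have h : traceExpr4 A = (completeHomog4 n (eigVec hA) : ℂ) := by
      rw [← traceExpr4_diagonal, hA.traceExpr4_eq, hD.traceExpr4_eq]
      simp only [h1, trace_pow_eq_sum_eigVec hA 2, trace_pow_eq_sum_eigVec hA 3,
        trace_pow_eq_sum_eigVec hA 4]
    exact_mod_cast (hN A).trans h
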